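/- For every positive integer n, the sum of w(π) over all overpartitions π ∈ EO̅* with |π| = n equals the number of quadruples (α, β, γ, δ) of partitions with |α| + |β| + |γ| + |δ| = n, where α is a partition into distinct parts all divisible by 4, β and γ are partitions into distinct parts congruent to 4 modulo 8, and δ is a partition into parts congruent to 4 modulo 8. -/

import Mathlib

/-- A partition is a finite multiset of positive integers. -/
def IsPartition (m : Multiset ℕ) : Prop := ∀ x ∈ m, 0 < x

/-- The largest even part of a partition (0 if there are no even parts). -/
def lep (m : Multiset ℕ) : ℕ := (m.filter (fun x => Even x)).sup

/-- `EO*`: every even part is smaller than every odd part, every part other than the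
largest even part appears an even number of times, and the largest even part appears
an odd number of times. -/
def EOStar (m : Multiset ℕ) : Prop :=
  IsPartition m ∧
  (∀ x ∈ m, ∀ y ∈ m, Even x → Odd y → x < y) ∧
  (∀ x ∈ m, x ≠ lep m → Even (m.count x)) ∧
  (∀ x ∈ m, x = lep m → Odd (m.count x))

/-- `E*`: partitions into even parts where each distinct part appears an even number of times. -/
def EStar (m : Multiset ℕ) : Prop :=
  IsPartition m ∧ (∀ x ∈ m, Even x) ∧ ∀ x : ℕ, Even (m.count x)

/-- `O_k*`: partitions into odd parts with exactly `2k` parts where each distinct part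
appears an even number of times. -/
def OStar (k : ℕ) (m : Multiset ℕ) : Prop :=
  IsPartition m ∧ (∀ x ∈ m, Odd x) ∧ Multiset.card m = 2 * k ∧ ∀ x : ℕ, Even (m.count x)

/-- `Q_{k,r}`: partitions with a `(k+r+1) × k` Durfee rectangle whose largest part below
the rectangle is `< k+r+1`; equivalently, exactly `k` parts are `≥ k+r+1`. -/
def QSet (k r : ℕ) (m : Multiset ℕ) : Prop :=
  IsPartition m ∧ Multiset.card (m.filter (fun x => k + r + 1 ≤ x)) = k

/-- `EO*_{k,r}`: partitions in `EO*` with exactly `2k` odd parts and largest even part `2k+2r`. -/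
def EOkr (k r : ℕ) (m : Multiset ℕ) : Prop :=
  EOStar m ∧ Multiset.card (m.filter (fun x => Odd x)) = 2 * k ∧ lep m = 2 * k + 2 * r

/-- The even-odd crank: largest even part minus the number of odd parts. -/
def eoc (m : Multiset ℕ) : ℤ :=
  (lep m : ℤ) - (Multiset.card (m.filter (fun x => Odd x)) : ℤ)

/-- The conjugate partition: its `i`-th part is the number of parts that are `≥ i`. -/
def conjugate (m : Multiset ℕ) : Multiset ℕ :=
  (Multiset.range m.sup).map (fun i => Multiset.card (m.filter (fun x => i + 1 ≤ x)))

/-- An overpartition: a partition together with a set of overlined part values, which must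
be a subset of the distinct part values. -/
def IsOverpartition (p : Multiset ℕ × Finset ℕ) : Prop :=
  IsPartition p.1 ∧ p.2 ⊆ p.1.toFinset


/-- `EO̅*`: overpartitions in which every even part is below every odd part and only the
largest even part appears an odd number of times (overlined and non-overlined occurrences
counted together). -/
def OverEOStar (p : Multiset ℕ × Finset ℕ) : Prop :=
  IsOverpartition p ∧
  (∀ x ∈ p.1, ∀ y ∈ p.1, Even x → Odd y → x < y) ∧
  (∀ x ∈ p.1, x ≠ lep p.1 → Even (p.1.count x)) ∧
  (∀ x ∈ p.1, x = lep p.1 → Odd (p.1.count x))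


section KummerSum

open PowerSeries Finset

variable {K : Type*} [Field K]

theorem PowerSeries.isUnit_one_sub_of_constantCoeff_ne_one {b : K⟦X⟧}
    (hb : constantCoeff b ≠ 1) : IsUnit (1 - b) := by
  rw [isUnit_iff_constantCoeff, map_sub, map_one]
  exact (sub_ne_zero.2 hb.symm).isUnit

theorem PowerSeries.isUnit_one_sub_mul_pow {q : K⟦X⟧} (hq : constantCoeff q = 0) (a : K⟦X⟧)
    (n : ℕ) : IsUnit (1 - a * q ^ (n + 1)) :=
  isUnit_one_sub_of_constantCoeff_ne_one (by simp [hq])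

theorem PowerSeries.isUnit_one_sub_pow {q : K⟦X⟧} (hq : constantCoeff q = 0) (n : ℕ) :
    IsUnit (1 - q ^ (n + 1)) := by
  simpa using isUnit_one_sub_mul_pow hq 1 n

theorem PowerSeries.mul_inv_cancel_of_isUnit {u : K⟦X⟧} (hu : IsUnit u) : u * u⁻¹ = 1 :=
  PowerSeries.mul_inv_cancel _ (isUnit_iff_constantCoeff.1 hu).ne_zero

/-- The `n`-th term of the basic hypergeometric series `₂φ₁(a, q; aq; q², -q)`. -/
noncomputable def kummerTerm (q a : K⟦X⟧) (n : ℕ) : K⟦X⟧ :=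
  (-q) ^ n * ∏ i ∈ range n, ((1 - a * q ^ (2 * i)) * (1 - q ^ (2 * i + 1)) *
    ((1 - q ^ (2 * i + 2)) * (1 - a * q ^ (2 * i + 1)))⁻¹)

/-- The `n`-th term of the basic hypergeometric series `₁φ₀(q; q², z)`. -/
noncomputable def binomialTerm (q z : K⟦X⟧) (n : ℕ) : K⟦X⟧ :=
  z ^ n * ∏ i ∈ range n, ((1 - q ^ (2 * i + 1)) * (1 - q ^ (2 * i + 2))⁻¹)

variable {q : K⟦X⟧}

theorem kummerTerm_succ (hq : constantCoeff q = 0) (a : K⟦X⟧) (n : ℕ) :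
    ((1 - q ^ (2 * n + 2)) * (1 - a * q ^ (2 * n + 1))) * kummerTerm q a (n + 1) =
      -q * (1 - a * q ^ (2 * n)) * (1 - q ^ (2 * n + 1)) * kummerTerm q a n := by
  have h := mul_inv_cancel_of_isUnit
    ((isUnit_one_sub_pow hq (2 * n + 1)).mul (isUnit_one_sub_mul_pow hq a (2 * n)))
  simp only [kummerTerm, prod_range_succ, pow_succ (-q) n]
  linear_combination (-q * (1 - a * q ^ (2 * n)) * (1 - q ^ (2 * n + 1)) * ((-q) ^ n *
    ∏ i ∈ range n, ((1 - a * q ^ (2 * i)) * (1 - q ^ (2 * i + 1)) *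
    ((1 - q ^ (2 * i + 2)) * (1 - a * q ^ (2 * i + 1)))⁻¹))) * h

theorem kummerTerm_mul_pow_four (hq : constantCoeff q = 0) (a : K⟦X⟧) (n : ℕ) :
    (1 - a) * (1 - a * q ^ 2) * (1 - a * q ^ (2 * n + 1)) * (1 - a * q ^ (2 * n + 3)) *
        kummerTerm q (a * q ^ 4) n =
      (1 - a * q) * (1 - a * q ^ 3) * (1 - a * q ^ (2 * n)) * (1 - a * q ^ (2 * n + 2)) *
        kummerTerm q a n := by
  induction n with
  | zero => simp [kummerTerm]; ring
  | succ n ih =>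
    have h₁ := kummerTerm_succ hq a n
    have h₂ := kummerTerm_succ hq (a * q ^ 4) n
    have hu := ((isUnit_one_sub_pow hq (2 * n + 1)).mul
      (isUnit_one_sub_mul_pow hq a (2 * n))).mul (isUnit_one_sub_mul_pow hq a (2 * n + 4))
    refine hu.mul_left_cancel ?_
    linear_combination (1 - a) * (1 - a * q ^ 2) * (1 - a * q ^ (2 * n + 3)) *
        (1 - a * q ^ (2 * n + 5)) * (1 - a * q ^ (2 * n + 1)) * h₂ -
      (1 - a * q) * (1 - a * q ^ 3) * (1 - a * q ^ (2 * n + 2)) * (1 - a * q ^ (2 * n + 4)) *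
        (1 - a * q ^ (2 * n + 5)) * h₁ -
      q * (1 - a * q ^ (2 * n + 4)) * (1 - q ^ (2 * n + 1)) * (1 - a * q ^ (2 * n + 5)) * ih

theorem sum_kummerTerm_telescope (hq : constantCoeff q = 0) (a : K⟦X⟧) (n : ℕ) :
    (1 - a * q ^ (2 * n + 1)) * ((1 - a) *
        ((1 - a * q) * (1 - a * q ^ 3) * ∑ i ∈ range n, kummerTerm q a i -
          (1 - a * q ^ 2) ^ 2 * ∑ i ∈ range n, kummerTerm q (a * q ^ 4) i)) =
      a * (1 - q) * (1 - q ^ (2 * n)) * (1 - a * q) * (1 - a * q ^ 3) * kummerTerm q a n := by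
  induction n with
  | zero => simp
  | succ n ih =>
    have h₁ := kummerTerm_succ hq a n
    have h₂ := kummerTerm_mul_pow_four hq a n
    refine (isUnit_one_sub_mul_pow hq a (2 * n)).mul_left_cancel ?_
    simp only [sum_range_succ]
    linear_combination (1 - a * q ^ (2 * n + 3)) * ih - (1 - a * q ^ 2) * h₂ -
      a * (1 - q) * (1 - a * q) * (1 - a * q ^ 3) * h₁

theorem pow_dvd_kummerTerm (q a : K⟦X⟧) (n : ℕ) : q ^ n ∣ kummerTerm q a n :=
  ((pow_dvd_pow_of_dvd (dvd_neg.2 dvd_rfl) n)).mul_right _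

theorem pow_dvd_sum_kummerTerm_sub (hq : constantCoeff q = 0) {a : K⟦X⟧}
    (ha : constantCoeff a ≠ 1) (n : ℕ) :
    q ^ n ∣ (1 - a * q) * (1 - a * q ^ 3) * ∑ i ∈ range n, kummerTerm q a i -
      (1 - a * q ^ 2) ^ 2 * ∑ i ∈ range n, kummerTerm q (a * q ^ 4) i := by
  rw [← (isUnit_one_sub_of_constantCoeff_ne_one ha).dvd_mul_left,
    ← (isUnit_one_sub_mul_pow hq a (2 * n)).dvd_mul_left, sum_kummerTerm_telescope hq]
  exact (pow_dvd_kummerTerm q a n).mul_left _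

theorem pow_dvd_prod_mul_sum_kummerTerm_sub (hq : constantCoeff q = 0) {a : K⟦X⟧}
    (ha : constantCoeff a ≠ 1) (n J : ℕ) :
    q ^ n ∣ (∏ j ∈ range J, (1 - a * q ^ (4 * j + 1)) * (1 - a * q ^ (4 * j + 3))) *
        ∑ i ∈ range n, kummerTerm q a i -
      (∏ j ∈ range J, (1 - a * q ^ (4 * j + 2)) ^ 2) *
        ∑ i ∈ range n, kummerTerm q (a * q ^ (4 * J)) i := by
  induction J with
  | zero => simp
  | succ J ih =>
    have hb : constantCoeff (a * q ^ (4 * J)) ≠ 1 := by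
      rcases J with _ | J <;> simp [hq, ha]
    have h := pow_dvd_sum_kummerTerm_sub hq hb n
    rw [show a * q ^ (4 * J) * q ^ 4 = a * q ^ (4 * (J + 1)) by ring] at h
    have := dvd_add (ih.mul_left ((1 - a * q ^ (4 * J + 1)) * (1 - a * q ^ (4 * J + 3))))
      (h.mul_left (∏ j ∈ range J, (1 - a * q ^ (4 * j + 2)) ^ 2))
    simp only [prod_range_succ]
    convert! this using 1
    ring

theorem dvd_kummerTerm_sub (hq : constantCoeff q = 0) (b : K⟦X⟧) (n : ℕ) :
    b ∣ kummerTerm q b n - kummerTerm q 0 n := by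
  induction n with
  | zero => simp [kummerTerm]
  | succ n ih =>
    have h₁ := kummerTerm_succ hq b n
    have h₂ := kummerTerm_succ hq 0 n
    rw [← ((isUnit_one_sub_pow hq (2 * n + 1)).mul
      (isUnit_one_sub_mul_pow hq b (2 * n))).dvd_mul_left]
    obtain ⟨c, hc⟩ := ih
    refine ⟨-q * (1 - q ^ (2 * n + 1)) * (c - q ^ (2 * n) * kummerTerm q b n +
      q ^ (2 * n + 1) * kummerTerm q 0 n), ?_⟩
    linear_combination h₁ - (1 - b * q ^ (2 * n + 1)) * h₂ -
      q * (1 - q ^ (2 * n + 1)) * hc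

theorem binomialTerm_succ (hq : constantCoeff q = 0) (z : K⟦X⟧) (n : ℕ) :
    (1 - q ^ (2 * n + 2)) * binomialTerm q z (n + 1) =
      z * (1 - q ^ (2 * n + 1)) * binomialTerm q z n := by
  have h := mul_inv_cancel_of_isUnit (isUnit_one_sub_pow hq (2 * n + 1))
  simp only [binomialTerm, prod_range_succ, pow_succ z n]
  linear_combination (z * (1 - q ^ (2 * n + 1)) * (z ^ n *
    ∏ i ∈ range n, ((1 - q ^ (2 * i + 1)) * (1 - q ^ (2 * i + 2))⁻¹))) * h

theorem kummerTerm_zero_eq_binomialTerm (q : K⟦X⟧) (n : ℕ) :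
    kummerTerm q 0 n = binomialTerm q (-q) n := by
  simp [kummerTerm, binomialTerm]

theorem sum_binomialTerm_telescope (hq : constantCoeff q = 0) (z : K⟦X⟧) (n : ℕ) :
    (1 - z) * ∑ i ∈ range n, binomialTerm q z i -
        (1 - z * q) * ∑ i ∈ range n, binomialTerm q (z * q ^ 2) i =
      -(1 - q ^ (2 * n)) * binomialTerm q z n := by
  induction n with
  | zero => simp
  | succ n ih =>
    have h₁ := binomialTerm_succ hq z n
    have h₂ : binomialTerm q (z * q ^ 2) n = q ^ (2 * n) * binomialTerm q z n := by
      simp only [binomialTerm]; ring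
    simp only [sum_range_succ]
    linear_combination ih + h₁ - (1 - z * q) * h₂

theorem pow_dvd_prod_mul_sum_binomialTerm_sub (hq : constantCoeff q = 0) {z : K⟦X⟧}
    (hz : q ∣ z) (n J : ℕ) :
    q ^ n ∣ (∏ j ∈ range J, (1 - z * q ^ (2 * j))) * ∑ i ∈ range n, binomialTerm q z i -
      (∏ j ∈ range J, (1 - z * q ^ (2 * j + 1))) *
        ∑ i ∈ range n, binomialTerm q (z * q ^ (2 * J)) i := by
  induction J with
  | zero => simp
  | succ J ih =>
    have h : q ^ n ∣ _ := (((pow_dvd_pow_of_dvd (hz.mul_right (q ^ (2 * J))) n).mul_right _).mul_left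
      _).trans (sum_binomialTerm_telescope hq (z * q ^ (2 * J)) n).symm.dvd
    rw [show z * q ^ (2 * J) * q ^ 2 = z * q ^ (2 * (J + 1)) by ring] at h
    have := dvd_add (ih.mul_left (1 - z * q ^ (2 * J)))
      (h.mul_left (∏ j ∈ range J, (1 - z * q ^ (2 * j + 1))))
    simp only [prod_range_succ]
    convert! this using 1
    ring

theorem dvd_sum_binomialTerm_sub_one (q z : K⟦X⟧) {n : ℕ} (hn : 0 < n) :
    z ∣ ∑ i ∈ range n, binomialTerm q z i - 1 := by
  obtain ⟨n, rfl⟩ := Nat.exists_eq_succ_of_ne_zero hn.ne'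
  rw [Nat.succ_eq_add_one, sum_range_succ']
  simp only [binomialTerm, pow_zero, range_zero, prod_empty, mul_one, add_sub_cancel_right]
  exact dvd_sum fun i _ ↦ (dvd_pow_self z i.succ_ne_zero).mul_right _

theorem prod_range_two_mul {M : Type*} [CommMonoid M] (f : ℕ → M) (n : ℕ) :
    ∏ j ∈ range (2 * n), f j = ∏ j ∈ range n, (f (2 * j) * f (2 * j + 1)) := by
  induction n with
  | zero => simp
  | succ n ih =>
    rw [show 2 * (n + 1) = 2 * n + 1 + 1 by ring, prod_range_succ, prod_range_succ, ih,
      prod_range_succ, mul_assoc]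

/-- Truncation of the Bailey–Daum sum `₂φ₁(-1, q; -q; q², -q)`. -/
theorem pow_dvd_prod_mul_sum_kummerTerm_neg_one_sub [CharZero K] (hq : constantCoeff q = 0)
    {n J : ℕ} (hn : 0 < n) (hJ : n ≤ 4 * J) :
    q ^ n ∣ (∏ j ∈ range (2 * J), (1 + q ^ (2 * j + 1))) ^ 2 *
        ∑ i ∈ range n, kummerTerm q (-1) i -
      (∏ j ∈ range J, (1 + q ^ (4 * j + 2)) ^ 2) *
        ∏ j ∈ range (2 * J), (1 + q ^ (2 * j + 2)) := by
  have h₁ := pow_dvd_prod_mul_sum_kummerTerm_sub hq (a := -1) (by simp; norm_num) n J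
  have h₂ : q ^ n ∣ ∑ i ∈ range n, kummerTerm q (-1 * q ^ (4 * J)) i -
      ∑ i ∈ range n, kummerTerm q 0 i := by
    rw [← sum_sub_distrib]
    exact dvd_sum fun i _ ↦ ((pow_dvd_pow q hJ).mul_left _).trans (dvd_kummerTerm_sub hq _ i)
  have h₃ := pow_dvd_prod_mul_sum_binomialTerm_sub hq (z := -q) (dvd_neg.2 dvd_rfl) n (2 * J)
  have h₄ : q ^ n ∣ ∑ i ∈ range n, binomialTerm q (-q * q ^ (2 * (2 * J))) i - 1 := by
    have : n ≤ 2 * (2 * J) := by lia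
    exact ((pow_dvd_pow q this).mul_left _).trans (dvd_sum_binomialTerm_sub_one q _ hn)
  simp only [kummerTerm_zero_eq_binomialTerm] at h₂
  have e₁ : ∏ j ∈ range J, (1 - -1 * q ^ (4 * j + 1)) * (1 - -1 * q ^ (4 * j + 3)) =
      ∏ j ∈ range (2 * J), (1 + q ^ (2 * j + 1)) := by
    rw [prod_range_two_mul]
    exact prod_congr rfl fun j _ ↦ by ring
  have e₂ : ∏ j ∈ range (2 * J), (1 - -q * q ^ (2 * j)) =
      ∏ j ∈ range (2 * J), (1 + q ^ (2 * j + 1)) := prod_congr rfl fun j _ ↦ by ring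
  have e₃ : ∏ j ∈ range (2 * J), (1 - -q * q ^ (2 * j + 1)) =
      ∏ j ∈ range (2 * J), (1 + q ^ (2 * j + 2)) := prod_congr rfl fun j _ ↦ by ring
  have e₄ : ∏ j ∈ range J, (1 - -1 * q ^ (4 * j + 2)) ^ 2 =
      ∏ j ∈ range J, (1 + q ^ (4 * j + 2)) ^ 2 := prod_congr rfl fun j _ ↦ by ring
  rw [e₁, e₄] at h₁
  rw [e₂, e₃] at h₃
  generalize ∏ j ∈ range (2 * J), (1 + q ^ (2 * j + 1)) = A at *
  generalize ∏ j ∈ range J, (1 + q ^ (4 * j + 2)) ^ 2 = C at *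
  generalize ∏ j ∈ range (2 * J), (1 + q ^ (2 * j + 2)) = D at *
  have := dvd_add (dvd_add (h₁.mul_left A) (h₂.mul_left (A * C)))
    (dvd_add (h₃.mul_left C) (h₄.mul_left (C * D)))
  convert! this using 1
  ring

end KummerSum

section WeightSeries

open PowerSeries Finset

/-- The generating function of the elements of `S` by the weight `w`. -/
noncomputable def weightSeries {α : Type*} (S : Set α) (w : α → ℕ) : ℚ⟦X⟧ :=
  mk fun n ↦ ({a | a ∈ S ∧ w a = n}.ncard : ℚ)

theorem finite_prod_weight_eq {α β : Type*} {S : Set α} {T : Set β} {v : α → ℕ} {w : β → ℕ}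
    (hS : ∀ n, {a | a ∈ S ∧ v a = n}.Finite) (hT : ∀ n, {b | b ∈ T ∧ w b = n}.Finite) (n : ℕ) :
    {p : α × β | p ∈ S ×ˢ T ∧ v p.1 + w p.2 = n}.Finite := by
  refine ((antidiagonal n).finite_toSet.biUnion fun ij _ ↦ (hS ij.1).prod (hT ij.2)).subset ?_
  rintro ⟨a, b⟩ ⟨⟨ha, hb⟩, h⟩
  simp only [Set.mem_iUnion]
  exact ⟨(v a, w b), by simpa using h, ⟨ha, rfl⟩, ⟨hb, rfl⟩⟩

theorem weightSeries_mul {α β : Type*} {S : Set α} {T : Set β} {v : α → ℕ} {w : β → ℕ}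
    (hS : ∀ n, {a | a ∈ S ∧ v a = n}.Finite) (hT : ∀ n, {b | b ∈ T ∧ w b = n}.Finite) :
    weightSeries S v * weightSeries T w = weightSeries (S ×ˢ T) fun p ↦ v p.1 + w p.2 := by
  classical
  ext n
  have key : {p : α × β | p ∈ S ×ˢ T ∧ v p.1 + w p.2 = n} =
      ↑((antidiagonal n).biUnion fun ij ↦ (hS ij.1).toFinset ×ˢ (hT ij.2).toFinset) := by
    ext ⟨a, b⟩
    simp only [Set.mem_prod, Set.mem_ofPred_eq, mem_coe, mem_biUnion, HasAntidiagonal.mem_antidiagonal, mem_product,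
      Set.Finite.mem_toFinset, Prod.exists]
    grind
  rw [coeff_mul, weightSeries, weightSeries, weightSeries, coeff_mk, key, Set.ncard_coe_finset,
    card_biUnion]
  · push_cast
    refine sum_congr rfl fun ij _ ↦ ?_
    rw [card_product, coeff_mk, coeff_mk, Set.ncard_eq_toFinset_card _ (hS _),
      Set.ncard_eq_toFinset_card _ (hT _), Nat.cast_mul]
  · intro i _ j _ hij
    rw [Function.onFun, disjoint_left]
    simp only [mem_product, Set.Finite.mem_toFinset, Set.mem_ofPred_eq]
    rintro p ⟨⟨-, h₁⟩, -, h₂⟩ ⟨⟨-, h₃⟩, -, h₄⟩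
    exact hij (Prod.ext (h₁.symm.trans h₃) (h₂.symm.trans h₄))

end WeightSeries

section PartSeries

open PowerSeries Finset

/-- The generating function `∑ c, f c * X ^ (x * c)` of a single part size `x`, where `f c`
is the weight of `c` occurrences. -/
noncomputable def partSeries (x : ℕ) (f : ℕ → ℚ) : ℚ⟦X⟧ :=
  mk fun k ↦ if x ∣ k then f (k / x) else 0

theorem coeff_prod_partSeries (f : ℕ → ℕ → ℚ) {n L : ℕ} (h : n ≤ L) :
    coeff n (∏ x ∈ Icc 1 L, partSeries x (f x)) =
      ∑ p : n.Partition, ∏ x ∈ Icc 1 L, f x (p.parts.count x) := by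
  rw [coeff_prod]
  refine (sum_of_injOn Nat.Partition.toFinsuppAntidiag
    (Nat.Partition.toFinsuppAntidiag_injective n).injOn ?_ ?_ ?_).symm
  · intro p _
    exact mem_of_subset (finsuppAntidiag_mono (Icc_subset_Icc_right h) _)
      p.toFinsuppAntidiag_mem_finsuppAntidiag
  · intro g hg hg'
    obtain ⟨hsum, hsupp⟩ := mem_finsuppAntidiag.1 hg
    by_contra hne
    have hdvd (x : ℕ) : x ∣ g x := by
      by_cases hx : x ∈ Icc 1 L
      · by_contra hx'
        exact hne (prod_eq_zero hx (by simp [partSeries, hx']))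
      · rw [Finsupp.notMem_support_iff.1 fun h ↦ hx (hsupp h)]
        exact dvd_zero x
    have hpos (x : ℕ) (hx : g x ≠ 0) : 0 < x :=
      (mem_Icc.1 (hsupp (Finsupp.mem_support_iff.2 hx))).1
    have hiff (x : ℕ) : x ∈ g.support ↔ g x / x ≠ 0 := by
      rw [Finsupp.mem_support_iff]
      refine ⟨fun hx ↦ (Nat.div_pos (Nat.le_of_dvd (Nat.pos_of_ne_zero hx) (hdvd x))
        (hpos x hx)).ne', fun hx h0 ↦ hx (by simp [h0])⟩
    refine hg' ⟨⟨(Finsupp.mk g.support (fun x ↦ g x / x) hiff).toMultiset, ?_, ?_⟩, by simp, ?_⟩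
    · intro x hx
      rw [Finsupp.mem_toMultiset] at hx
      exact hpos x (Finsupp.mem_support_iff.1 hx)
    · rw [Finsupp.sum_toMultiset]
      refine Eq.trans ?_ hsum
      simp only [Finsupp.sum, Finsupp.coe_mk, smul_eq_mul]
      exact sum_subset_zero_on_sdiff hsupp (by simp)
        fun x _ ↦ Nat.div_mul_cancel (hdvd x)
    · ext x
      simpa [Nat.Partition.toFinsuppAntidiag] using Nat.div_mul_cancel (hdvd x)
  · intro p _
    refine prod_congr rfl fun x hx ↦ ?_
    have hx0 : 0 < x := (mem_Icc.1 hx).1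
    simp [partSeries, Nat.Partition.toFinsuppAntidiag, hx0]

theorem coeff_weightSeries_eq_coeff_prod {S : Set (Multiset ℕ)} {P : ℕ → ℕ → Prop}
    [∀ x, DecidablePred (P x)] {n L : ℕ} (hn : n ≤ L)
    (hS : ∀ m, m.sum ≤ L → (m ∈ S ↔ IsPartition m ∧ ∀ x ∈ Icc 1 L, P x (m.count x))) :
    coeff n (weightSeries S Multiset.sum) =
      coeff n (∏ x ∈ Icc 1 L, partSeries x fun c ↦ if P x c then 1 else 0) := by
  classical
  have key : {m | m ∈ S ∧ m.sum = n} =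
      ↑((univ.filter fun p : n.Partition ↦ ∀ x ∈ Icc 1 L, P x (p.parts.count x)).image
        Nat.Partition.parts) := by
    ext m
    simp only [Set.mem_ofPred_eq, mem_coe, mem_image, mem_filter, mem_univ, true_and]
    constructor
    · rintro ⟨hm, hs⟩
      obtain ⟨hpos, h⟩ := (hS m (hs.trans_le hn)).1 hm
      exact ⟨⟨m, fun {x} hx ↦ hpos x hx, hs⟩, h, rfl⟩
    · rintro ⟨p, h, rfl⟩
      exact ⟨(hS _ (p.parts_sum.trans_le hn)).2 ⟨fun x hx ↦ p.parts_pos hx, h⟩, p.parts_sum⟩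
  rw [coeff_prod_partSeries _ hn, weightSeries, coeff_mk, key, Set.ncard_coe_finset,
    card_image_of_injective _ fun _ _ ↦ Nat.Partition.ext, card_filter]
  push_cast
  refine sum_congr rfl fun p _ ↦ ?_
  rw [prod_ite_zero, prod_const_one]

theorem ncard_overpartition_eq_coeff_prod (P : ℕ → ℕ → Prop) [∀ x, DecidablePred (P x)]
    {n L : ℕ} (hn : n ≤ L) :
    ({p : Multiset ℕ × Finset ℕ | IsOverpartition p ∧ p.1.sum = n ∧
        ∀ x ∈ Icc 1 L, P x (p.1.count x)}.ncard : ℚ) =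
      coeff n (∏ x ∈ Icc 1 L,
        partSeries x fun c ↦ if P x c then if c = 0 then 1 else 2 else 0) := by
  classical
  have key : {p : Multiset ℕ × Finset ℕ | IsOverpartition p ∧ p.1.sum = n ∧
      ∀ x ∈ Icc 1 L, P x (p.1.count x)} =
      ↑((univ.filter fun p : n.Partition ↦ ∀ x ∈ Icc 1 L, P x (p.parts.count x)).biUnion
        fun p ↦ {p.parts} ×ˢ p.parts.toFinset.powerset) := by
    ext ⟨m, s⟩
    simp only [Set.mem_ofPred_eq, mem_coe, mem_biUnion, mem_filter, mem_univ, true_and,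
      mem_product, mem_singleton, mem_powerset]
    constructor
    · rintro ⟨⟨hpos, hs⟩, hsum, h⟩
      exact ⟨⟨m, fun {x} hx ↦ hpos x hx, hsum⟩, h, rfl, hs⟩
    · rintro ⟨p, h, rfl, hs⟩
      exact ⟨⟨fun x hx ↦ p.parts_pos hx, hs⟩, p.parts_sum, h⟩
  rw [coeff_prod_partSeries _ hn, key, Set.ncard_coe_finset, card_biUnion, sum_filter]
  · push_cast
    refine sum_congr rfl fun p _ ↦ ?_
    rw [prod_ite_zero, card_product, card_singleton, one_mul, card_powerset]
    have hsub : p.parts.toFinset ⊆ Icc 1 L := by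
      intro x hx
      rw [Multiset.mem_toFinset] at hx
      exact mem_Icc.2 ⟨p.parts_pos hx,
        ((Multiset.le_sum_of_mem hx).trans_eq p.parts_sum).trans hn⟩
    have hprod : ∏ x ∈ Icc 1 L, (if p.parts.count x = 0 then (1 : ℚ) else 2) =
        2 ^ p.parts.toFinset.card := by
      rw [← prod_const, eq_comm]
      refine prod_subset_one_on_sdiff hsub ?_ ?_
      · intro x hx
        simp only [mem_sdiff, Multiset.mem_toFinset] at hx
        simp [hx.2]
      · intro x hx
        rw [Multiset.mem_toFinset] at hx
        simp [hx]
    rw [hprod]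
    simp
  · intro p _ p' _ hne
    rw [Function.onFun, disjoint_left]
    simp only [mem_product, mem_singleton]
    rintro a ⟨h, -⟩ ⟨h', -⟩
    exact hne (Nat.Partition.ext (h.symm.trans h'))

theorem partSeries_add (x : ℕ) (f g : ℕ → ℚ) :
    partSeries x (fun c ↦ f c + g c) = partSeries x f + partSeries x g := by
  ext k
  simp only [partSeries, coeff_mk, map_add]
  split_ifs <;> simp

theorem partSeries_single {x : ℕ} (hx : 0 < x) (d : ℕ) (r : ℚ) :
    partSeries x (fun c ↦ if c = d then r else 0) = C r * X ^ (x * d) := by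
  ext k
  simp only [partSeries, coeff_mk, coeff_C_mul, coeff_X_pow, mul_ite, mul_one, mul_zero]
  by_cases hk : x ∣ k
  · obtain ⟨c, rfl⟩ := hk
    simp [hx.ne']
  · rw [if_neg hk, if_neg]
    rintro rfl
    exact hk (dvd_mul_right x d)

theorem one_sub_X_pow_mul_partSeries {x : ℕ} (hx : 0 < x) (d : ℕ) (f : ℕ → ℚ) :
    (1 - X ^ (x * d)) * partSeries x f =
      partSeries x fun c ↦ f c - if d ≤ c then f (c - d) else 0 := by
  ext k
  rw [sub_mul, one_mul, map_sub, coeff_X_pow_mul']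
  simp only [partSeries, coeff_mk]
  by_cases hk : x ∣ k
  · obtain ⟨c, rfl⟩ := hk
    rw [← Nat.mul_sub]
    simp [hx]
  · have : x * d ≤ k → ¬ x ∣ k - x * d := fun h h' ↦
      hk ((Nat.dvd_sub_iff_left h (dvd_mul_right x d)).1 h')
    rw [if_neg hk, if_neg hk]
    split_ifs with h₁ h₂ <;> simp_all

theorem partSeries_eq_zero_indicator {x : ℕ} (hx : 0 < x) :
    partSeries x (fun c ↦ if c = 0 then 1 else 0) = 1 := by
  simp [partSeries_single hx]

theorem partSeries_le_one_indicator {x : ℕ} (hx : 0 < x) :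
    partSeries x (fun c ↦ if c ≤ 1 then 1 else 0) = 1 + X ^ x := by
  have : (fun c : ℕ ↦ if c ≤ 1 then (1 : ℚ) else 0) =
      fun c ↦ (if c = 0 then 1 else 0) + if c = 1 then 1 else 0 := by
    funext c
    rcases c with _ | _ | c <;> simp
  rw [this, partSeries_add, partSeries_single hx, partSeries_single hx]
  simp

theorem one_sub_X_pow_mul_partSeries_one {x : ℕ} (hx : 0 < x) :
    (1 - X ^ x) * partSeries x (fun _ ↦ 1) = 1 := by
  have h := one_sub_X_pow_mul_partSeries hx 1 fun _ ↦ 1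
  rw [mul_one] at h
  rw [h, ← partSeries_eq_zero_indicator hx]
  congr 1
  funext c
  rcases c with _ | c <;> simp

theorem one_sub_X_pow_mul_partSeries_even {x : ℕ} (hx : 0 < x) :
    (1 - X ^ (x * 2)) * partSeries x (fun c ↦ if Even c then if c = 0 then 1 else 2 else 0) =
      1 + X ^ (x * 2) := by
  have : (fun c : ℕ ↦ (if Even c then if c = 0 then (1 : ℚ) else 2 else 0) -
      if 2 ≤ c then if Even (c - 2) then if c - 2 = 0 then 1 else 2 else 0 else 0) =
      fun c ↦ (if c = 0 then 1 else 0) + if c = 2 then 1 else 0 := by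
    funext c
    rcases c with _ | _ | _ | c
    · simp
    · simp
    · norm_num
    · simp [parity_simps]
  rw [one_sub_X_pow_mul_partSeries hx, this, partSeries_add, partSeries_single hx,
    partSeries_single hx]
  simp

theorem one_sub_X_pow_mul_partSeries_odd {x : ℕ} (hx : 0 < x) :
    (1 - X ^ (x * 2)) * partSeries x (fun c ↦ if Odd c then if c = 0 then 1 else 2 else 0) =
      2 * X ^ x := by
  have : (fun c : ℕ ↦ (if Odd c then if c = 0 then (1 : ℚ) else 2 else 0) -
      if 2 ≤ c then if Odd (c - 2) then if c - 2 = 0 then 1 else 2 else 0 else 0) =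
      fun c ↦ if c = 1 then 2 else 0 := by
    funext c
    rcases c with _ | _ | _ | c
    · simp
    · simp
    · simp
    · simp [parity_simps]
  rw [one_sub_X_pow_mul_partSeries hx, this, partSeries_single hx, mul_one]
  rfl

end PartSeries

section RestrictedParts

open PowerSeries Finset

theorem finite_isPartition_sum_eq {S : Set (Multiset ℕ)} (hS : ∀ m ∈ S, IsPartition m) (n : ℕ) :
    {m | m ∈ S ∧ m.sum = n}.Finite :=
  (Set.finite_range (Nat.Partition.parts (n := n))).subset fun m hm ↦
    ⟨⟨m, fun {x} hx ↦ hS m hm.1 x hx, hm.2⟩, rfl⟩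

theorem IsPartition.mem_Icc {m : Multiset ℕ} (hm : IsPartition m) {L x : ℕ} (hL : m.sum ≤ L)
    (hx : x ∈ m) : x ∈ Icc 1 L :=
  Finset.mem_Icc.2 ⟨hm x hx, (Multiset.le_sum_of_mem hx).trans hL⟩

theorem X_pow_dvd_sub_iff {f g : ℚ⟦X⟧} {N : ℕ} :
    X ^ N ∣ f - g ↔ ∀ n < N, coeff n f = coeff n g := by
  simp [X_pow_dvd_iff, sub_eq_zero]

theorem X_pow_dvd_weightSeries_distinct_sub (p : ℕ → Prop) [DecidablePred p] (L : ℕ) :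
    X ^ (L + 1) ∣ weightSeries {m : Multiset ℕ | IsPartition m ∧ m.Nodup ∧ ∀ x ∈ m, p x}
      Multiset.sum - ∏ x ∈ Icc 1 L with p x, (1 + X ^ x) := by
  rw [X_pow_dvd_sub_iff]
  intro n hn
  rw [coeff_weightSeries_eq_coeff_prod (P := fun x c ↦ if p x then c ≤ 1 else c = 0)
    (Nat.le_of_lt_succ hn), prod_filter]
  · congr 1
    refine prod_congr rfl fun x hx ↦ ?_
    have hx := (mem_Icc.1 hx).1
    by_cases h : p x
    · simp [h, partSeries_le_one_indicator hx]
    · simp [h, partSeries_eq_zero_indicator hx]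
  · intro m hm
    refine and_congr_right fun hpos ↦ ⟨fun ⟨h₁, h₂⟩ x _ ↦ ?_, fun h ↦ ⟨?_, ?_⟩⟩
    · split_ifs with hx
      · exact Multiset.nodup_iff_count_le_one.1 h₁ x
      · exact Multiset.count_eq_zero.2 fun hxm ↦ hx (h₂ x hxm)
    · rw [Multiset.nodup_iff_count_le_one]
      intro x
      by_cases hxm : x ∈ m
      · have := h x (hpos.mem_Icc hm hxm)
        split_ifs at this <;> lia
      · simp [Multiset.count_eq_zero.2 hxm]
    · intro x hxm
      by_contra hx
      have := h x (hpos.mem_Icc hm hxm)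
      rw [if_neg hx] at this
      exact Multiset.count_eq_zero.1 this hxm

theorem X_pow_dvd_weightSeries_mul_prod_sub_one (p : ℕ → Prop) [DecidablePred p] (L : ℕ) :
    X ^ (L + 1) ∣ weightSeries {m : Multiset ℕ | IsPartition m ∧ ∀ x ∈ m, p x}
      Multiset.sum * ∏ x ∈ Icc 1 L with p x, (1 - X ^ x) - 1 := by
  have key : X ^ (L + 1) ∣ weightSeries {m : Multiset ℕ | IsPartition m ∧ ∀ x ∈ m, p x}
      Multiset.sum - ∏ x ∈ Icc 1 L with p x, partSeries x fun _ ↦ 1 := by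
    rw [X_pow_dvd_sub_iff]
    intro n hn
    rw [coeff_weightSeries_eq_coeff_prod (P := fun x c ↦ p x ∨ c = 0)
      (Nat.le_of_lt_succ hn), prod_filter]
    · congr 1
      refine prod_congr rfl fun x hx ↦ ?_
      have hx := (mem_Icc.1 hx).1
      by_cases h : p x
      · simp [h]
      · simp [h, partSeries_eq_zero_indicator hx]
    · intro m hm
      refine and_congr_right fun hpos ↦ ⟨fun h x _ ↦ ?_, fun h x hxm ↦ ?_⟩
      · by_cases hxm : x ∈ m
        · exact .inl (h x hxm)
        · exact .inr (Multiset.count_eq_zero.2 hxm)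
      · exact (h x (hpos.mem_Icc hm hxm)).resolve_right (Multiset.count_ne_zero.2 hxm)
  convert! key.mul_right (∏ x ∈ Icc 1 L with p x, (1 - X ^ x)) using 1
  rw [sub_mul, ← prod_mul_distrib]
  congr 1
  refine (prod_eq_one fun x hx ↦ ?_).symm
  rw [mul_comm, one_sub_X_pow_mul_partSeries_one (mem_Icc.1 (mem_filter.1 hx).1).1]

theorem prod_Icc_filter_four_dvd {M : Type*} [CommMonoid M] (f : ℕ → M) (K : ℕ) :
    ∏ x ∈ Icc 1 (4 * K) with 4 ∣ x, f x = ∏ j ∈ range K, f (4 * j + 4) := by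
  refine prod_nbij' (fun x ↦ x / 4 - 1) (fun j ↦ 4 * j + 4) ?_ ?_ ?_ ?_ ?_ <;>
    simp only [mem_filter, mem_Icc, mem_range]
  · lia
  · lia
  · lia
  · lia
  · intro x hx
    congr 1
    lia

theorem prod_Icc_filter_mod_eight {M : Type*} [CommMonoid M] (f : ℕ → M) (K : ℕ) :
    ∏ x ∈ Icc 1 (8 * K) with x % 8 = 4, f x = ∏ j ∈ range K, f (8 * j + 4) := by
  refine prod_nbij' (fun x ↦ x / 8) (fun j ↦ 8 * j + 4) ?_ ?_ ?_ ?_ ?_ <;>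
    simp only [mem_filter, mem_Icc, mem_range]
  · lia
  · lia
  · lia
  · lia
  · intro x hx
    congr 1
    lia

theorem prod_Icc_two_mul {M : Type*} [CommMonoid M] (f : ℕ → M) (K : ℕ) :
    ∏ x ∈ Icc 1 (2 * K), f x =
      (∏ j ∈ range K, f (2 * j + 1)) * ∏ j ∈ range K, f (2 * j + 2) := by
  induction K with
  | zero => simp
  | succ K ih =>
    rw [show 2 * (K + 1) = 2 * K + 1 + 1 by ring, prod_Icc_succ_top (by lia),
      prod_Icc_succ_top (by lia), ih, prod_range_succ, prod_range_succ]
    exact (by rw [mul_assoc, mul_mul_mul_comm])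

theorem coeff_weightSeries {α : Type*} (S : Set α) (w : α → ℕ) (n : ℕ) :
    coeff n (weightSeries S w) = ({a | a ∈ S ∧ w a = n}.ncard : ℚ) :=
  coeff_mk _ _

/-- The generating function of the quadruples `(α, β, γ, δ)`, with the denominator cleared. -/
theorem exists_series_coeff_eq_ncard_quadruples (J : ℕ) :
    ∃ F : ℚ⟦X⟧, (∀ n, coeff n F = ({q : (Multiset ℕ × Multiset ℕ) × (Multiset ℕ × Multiset ℕ) |
        IsPartition q.1.1 ∧ q.1.1.Nodup ∧ (∀ x ∈ q.1.1, 4 ∣ x) ∧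
        q.1.2.Nodup ∧ (∀ x ∈ q.1.2, x % 8 = 4) ∧
        q.2.1.Nodup ∧ (∀ x ∈ q.2.1, x % 8 = 4) ∧
        (∀ x ∈ q.2.2, x % 8 = 4) ∧
        q.1.1.sum + q.1.2.sum + q.2.1.sum + q.2.2.sum = n}.ncard : ℚ)) ∧
      X ^ (8 * J + 1) ∣ F * ∏ j ∈ range (2 * J), (1 - X ^ (8 * j + 4)) -
        (∏ j ∈ range (2 * J), (1 + X ^ (4 * j + 4))) *
          (∏ j ∈ range J, (1 + X ^ (8 * j + 4))) ^ 2 := by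
  set A := {m : Multiset ℕ | IsPartition m ∧ m.Nodup ∧ ∀ x ∈ m, 4 ∣ x} with hA
  set B := {m : Multiset ℕ | IsPartition m ∧ m.Nodup ∧ ∀ x ∈ m, x % 8 = 4} with hB
  set D := {m : Multiset ℕ | IsPartition m ∧ ∀ x ∈ m, x % 8 = 4} with hD
  have fA := finite_isPartition_sum_eq (S := A) fun m hm ↦ hm.1
  have fB := finite_isPartition_sum_eq (S := B) fun m hm ↦ hm.1
  have fD := finite_isPartition_sum_eq (S := D) fun m hm ↦ hm.1
  have hpos {m : Multiset ℕ} (h : ∀ x ∈ m, x % 8 = 4) : IsPartition m := fun x hx ↦ by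
    have := h x hx
    lia
  refine ⟨(weightSeries A Multiset.sum * weightSeries B Multiset.sum) *
    (weightSeries B Multiset.sum * weightSeries D Multiset.sum), fun n ↦ ?_, ?_⟩
  · rw [weightSeries_mul fA fB, weightSeries_mul fB fD,
      weightSeries_mul (finite_prod_weight_eq fA fB) (finite_prod_weight_eq fB fD),
      coeff_weightSeries]
    congr 2
    ext ⟨⟨a, b⟩, c, d⟩
    simp only [Set.mem_ofPred_eq, Set.mem_prod, hA, hB, hD, add_assoc]
    constructor
    · rintro ⟨⟨⟨⟨h₁, h₂, h₃⟩, -, h₄, h₅⟩, ⟨-, h₆, h₇⟩, -, h₈⟩, h⟩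
      exact ⟨h₁, h₂, h₃, h₄, h₅, h₆, h₇, h₈, h⟩
    · rintro ⟨h₁, h₂, h₃, h₄, h₅, h₆, h₇, h₈, h⟩
      exact ⟨⟨⟨⟨h₁, h₂, h₃⟩, hpos h₅, h₄, h₅⟩, ⟨hpos h₇, h₆, h₇⟩, hpos h₈, h₈⟩, h⟩
  · have hα := X_pow_dvd_weightSeries_distinct_sub (fun x ↦ 4 ∣ x) (4 * (2 * J))
    have hβ := X_pow_dvd_weightSeries_distinct_sub (fun x ↦ x % 8 = 4) (8 * J)
    have hδ := X_pow_dvd_weightSeries_mul_prod_sub_one (fun x ↦ x % 8 = 4) (8 * (2 * J))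
    rw [prod_Icc_filter_four_dvd, ← hA, show 4 * (2 * J) = 8 * J by ring] at hα
    rw [prod_Icc_filter_mod_eight, ← hB] at hβ
    rw [prod_Icc_filter_mod_eight, ← hD] at hδ
    replace hδ := (pow_dvd_pow (X : ℚ⟦X⟧) (show 8 * J + 1 ≤ 8 * (2 * J) + 1 by lia)).trans hδ
    generalize weightSeries A Multiset.sum = a at *
    generalize weightSeries B Multiset.sum = b at *
    generalize weightSeries D Multiset.sum = d at *
    generalize ∏ j ∈ range (2 * J), (1 + X ^ (4 * j + 4) : ℚ⟦X⟧) = a' at *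
    generalize ∏ j ∈ range J, (1 + X ^ (8 * j + 4) : ℚ⟦X⟧) = b' at *
    convert! dvd_add (hδ.mul_left (a * b * b)) (dvd_add (hα.mul_left (b * b))
      (hβ.mul_left (a' * (b + b')))) using 1
    ring

end RestrictedParts

section EvenOdd

open PowerSeries Finset

theorem even_lep (m : Multiset ℕ) : Even (lep m) := by
  unfold lep
  induction m using Multiset.induction with
  | empty => simp
  | cons a s ih =>
    by_cases ha : Even a
    · rw [Multiset.filter_cons_of_pos _ ha, Multiset.sup_cons]
      rcases max_choice a (s.filter fun x ↦ Even x).sup with h | h <;> simp_all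
    · rwa [Multiset.filter_cons_of_neg _ ha]

theorem lep_mem {m : Multiset ℕ} (h : lep m ≠ 0) : lep m ∈ m := by
  unfold lep at *
  induction m using Multiset.induction with
  | empty => simp at h
  | cons a s ih =>
    by_cases ha : Even a
    · rw [Multiset.filter_cons_of_pos _ ha, Multiset.sup_cons] at h ⊢
      rcases max_choice a (s.filter fun x ↦ Even x).sup with h' | h'
      · simp [h']
      · simp_all
    · rw [Multiset.filter_cons_of_neg _ ha] at h ⊢
      exact Multiset.mem_cons_of_mem (ih h)

theorem le_lep {m : Multiset ℕ} {x : ℕ} (hx : x ∈ m) (he : Even x) : x ≤ lep m :=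
  Multiset.le_sup (Multiset.mem_filter.2 ⟨hx, he⟩)

theorem lep_le_sum (m : Multiset ℕ) : lep m ≤ m.sum := by
  by_cases h : lep m = 0
  · simp [h]
  · exact Multiset.le_sum_of_mem (lep_mem h)

/-- The condition on the multiplicity `c` of the part `x` for a partition satisfying the parity
conditions with largest even part `2 * r`. -/
def EOCount (r x c : ℕ) : Prop :=
  if Even x then if x < 2 * r then Even c else if x = 2 * r then Odd c else c = 0
  else if x < 2 * r then c = 0 else Even c

instance (r x : ℕ) : DecidablePred (EOCount r x) := fun c ↦ by
  unfold EOCount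
  infer_instance

theorem overEOStar_and_lep_eq_iff {p : Multiset ℕ × Finset ℕ} {r L : ℕ} (hp : p.1.sum ≤ L)
    (hr : 2 * r ≤ L) :
    OverEOStar p ∧ lep p.1 = 2 * r ↔
      IsOverpartition p ∧ ∀ x ∈ Icc 1 L, EOCount r x (p.1.count x) := by
  obtain ⟨m, s⟩ := p
  simp only at *
  constructor
  · rintro ⟨⟨ho, hlt, heven, hodd⟩, hlep⟩
    simp only at *
    refine ⟨ho, fun x hx ↦ ?_⟩
    have hx1 := (mem_Icc.1 hx).1
    have hcount : x ≠ 2 * r → Even (m.count x) := fun h ↦ by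
      by_cases hxm : x ∈ m
      · exact heven x hxm (hlep ▸ h)
      · simp [Multiset.count_eq_zero.2 hxm]
    unfold EOCount
    split_ifs with h₁ h₂ h₃ h₄
    · exact hcount h₂.ne
    · subst h₃
      exact hodd _ (hlep ▸ lep_mem (by lia)) hlep.symm
    · exact Multiset.count_eq_zero.2 fun hxm ↦ by
        have := le_lep hxm h₁
        lia
    · exact Multiset.count_eq_zero.2 fun hxm ↦ by
        have := hlt (lep m) (lep_mem (by lia)) x hxm (even_lep m) (Nat.not_even_iff_odd.1 h₁)
        lia
    · exact hcount fun h ↦ h₁ (h ▸ even_two_mul r)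
  · rintro ⟨ho, h⟩
    have hmem {x : ℕ} (hx : x ∈ m) : EOCount r x (m.count x) := h x (ho.1.mem_Icc hp hx)
    have hle {x : ℕ} (hx : x ∈ m) (he : Even x) : x ≤ 2 * r := by
      by_contra! hlt
      have := hmem hx
      rw [EOCount, if_pos he, if_neg hlt.le.not_gt, if_neg hlt.ne'] at this
      exact Multiset.count_ne_zero.2 hx this
    have hlep : lep m = 2 * r := by
      apply le_antisymm
      · by_cases h0 : lep m = 0
        · simp [h0]
        · exact hle (lep_mem h0) (even_lep m)
      · rcases Nat.eq_zero_or_pos r with rfl | hr0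
        · simp
        · have := h (2 * r) (mem_Icc.2 ⟨by lia, hr⟩)
          rw [EOCount, if_pos (even_two_mul r), if_neg (lt_irrefl _), if_pos rfl] at this
          exact le_lep (Multiset.count_pos.1 this.pos) (even_two_mul r)
    refine ⟨⟨ho, fun x hx y hy hex hoy ↦ ?_, fun x hx hne ↦ ?_, fun x hx heq ↦ ?_⟩, hlep⟩
    · refine (hle hx hex).trans_lt ?_
      have := hmem hy
      rw [EOCount, if_neg (Nat.not_even_iff_odd.2 hoy)] at this
      split_ifs at this with h₁
      · exact absurd this (Multiset.count_ne_zero.2 hy)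
      · refine lt_of_le_of_ne (not_lt.1 h₁) fun h ↦ ?_
        exact Nat.not_even_iff_odd.2 hoy (h ▸ even_two_mul r)
    · have := hmem hx
      simp only [hlep] at hne
      unfold EOCount at this
      split_ifs at this <;> simp_all
    · have := hmem hx
      simp only [hlep] at heq
      subst heq
      simpa [EOCount] using this

theorem one_sub_pow_mul_partSeries_even {x : ℕ} (hx : 0 < x) :
    (1 - (X ^ 2) ^ x) * partSeries x (fun c ↦ if Even c then if c = 0 then 1 else 2 else 0) =
      1 + (X ^ 2) ^ x := by
  rw [← pow_mul, mul_comm 2, one_sub_X_pow_mul_partSeries_even hx]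

theorem prod_partSeries_odd_mul {r K : ℕ} (hr : r ≤ K) :
    (∏ j ∈ range K, partSeries (2 * j + 1)
        (fun c ↦ if EOCount r (2 * j + 1) c then if c = 0 then 1 else 2 else 0)) *
        ∏ j ∈ Ico r K, (1 - (X ^ 2) ^ (2 * j + 1)) =
      ∏ j ∈ Ico r K, (1 + (X ^ 2) ^ (2 * j + 1)) := by
  have hodd (j : ℕ) : ¬ Even (2 * j + 1) := by simp
  rw [← prod_range_mul_prod_Ico _ hr, prod_eq_one, one_mul, ← prod_mul_distrib]
  · refine prod_congr rfl fun j hj ↦ ?_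
    have : ¬ 2 * j + 1 < 2 * r := by
      have := (mem_Ico.1 hj).1
      lia
    simp only [EOCount, if_neg (hodd j), if_neg this]
    rw [mul_comm, one_sub_pow_mul_partSeries_even (by lia)]
  · intro j hj
    have : 2 * j + 1 < 2 * r := by
      have := mem_range.1 hj
      lia
    simp only [EOCount, if_neg (hodd j), if_pos this]
    convert! partSeries_eq_zero_indicator (x := 2 * j + 1) (by lia) using 2
    grind

theorem prod_partSeries_even_mul {r K : ℕ} (hr : r ≤ K) :
    (∏ j ∈ range K, partSeries (2 * j + 2)
        (fun c ↦ if EOCount r (2 * j + 2) c then if c = 0 then 1 else 2 else 0)) *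
        ∏ j ∈ range r, (1 - (X ^ 2) ^ (2 * j + 2)) =
      (X ^ 2) ^ r * ∏ j ∈ range r, (1 + (X ^ 2) ^ (2 * j)) := by
  have heven (j : ℕ) : Even (2 * j + 2) := by simp [parity_simps]
  have hIco : ∏ j ∈ Ico r K, partSeries (2 * j + 2)
      (fun c ↦ if EOCount r (2 * j + 2) c then if c = 0 then 1 else 2 else 0) = 1 := by
    refine prod_eq_one fun j hj ↦ ?_
    have hj := (mem_Ico.1 hj).1
    simp only [EOCount, if_pos (heven j), if_neg (show ¬ 2 * j + 2 < 2 * r by lia),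
      if_neg (show ¬ 2 * j + 2 = 2 * r by lia)]
    convert! partSeries_eq_zero_indicator (x := 2 * j + 2) (by lia) using 2
    grind
  rw [← prod_range_mul_prod_Ico _ hr, hIco, mul_one, ← prod_mul_distrib]
  rcases r with _ | r
  · simp
  · rw [prod_range_succ, prod_range_succ']
    have h₁ : ∀ j ∈ range r, partSeries (2 * j + 2)
        (fun c ↦ if EOCount (r + 1) (2 * j + 2) c then if c = 0 then 1 else 2 else 0) *
        (1 - (X ^ 2) ^ (2 * j + 2)) = 1 + (X ^ 2) ^ (2 * (j + 1)) := by
      intro j hj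
      have : 2 * j + 2 < 2 * (r + 1) := by
        have := mem_range.1 hj
        lia
      simp only [EOCount, if_pos (heven j), if_pos this]
      rw [mul_comm, one_sub_pow_mul_partSeries_even (by lia), mul_add_one]
    rw [prod_congr rfl h₁]
    simp only [EOCount, if_pos (heven r), if_neg (show ¬ 2 * r + 2 < 2 * (r + 1) by lia),
      if_pos (show 2 * r + 2 = 2 * (r + 1) by lia)]
    have h₂ := one_sub_X_pow_mul_partSeries_odd (x := 2 * r + 2) (by lia)
    rw [mul_comm (2 * r + 2) 2, pow_mul] at h₂
    rw [mul_comm (partSeries _ _), h₂]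
    ring

/-- The generating function of overpartitions with largest even part `2 * r` is, up to an
infinite product independent of `r`, a term of the Bailey–Daum sum. -/
theorem prod_partSeries_eoCount_mul {r K : ℕ} (hr : r ≤ K) :
    (-1) ^ r * (∏ x ∈ Icc 1 (2 * K), partSeries x
        fun c ↦ if EOCount r x c then if c = 0 then 1 else 2 else 0) *
        ∏ j ∈ range K, (1 - (X ^ 2) ^ (2 * j + 1)) =
      (∏ j ∈ range K, (1 + (X ^ 2) ^ (2 * j + 1))) * kummerTerm (X ^ 2 : ℚ⟦X⟧) (-1) r := by
  have hq : constantCoeff (X ^ 2 : ℚ⟦X⟧) = 0 := by simp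
  have hg : IsUnit (∏ j ∈ range r, (1 - (X ^ 2 : ℚ⟦X⟧) ^ (2 * j + 2))) :=
    IsUnit.prod_iff.2 fun j _ ↦ isUnit_one_sub_pow hq (2 * j + 1)
  have hk : (∏ j ∈ range r, (1 - (X ^ 2 : ℚ⟦X⟧) ^ (2 * j + 2))) *
      (∏ j ∈ range r, (1 + (X ^ 2) ^ (2 * j + 1))) * kummerTerm (X ^ 2) (-1) r =
      (-1) ^ r * (X ^ 2) ^ r * (∏ j ∈ range r, (1 + (X ^ 2) ^ (2 * j))) *
        ∏ j ∈ range r, (1 - (X ^ 2) ^ (2 * j + 1)) := by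
    rw [kummerTerm, neg_pow, mul_left_comm, mul_assoc (_ * _)]
    congr 1
    simp only [← prod_mul_distrib]
    refine prod_congr rfl fun j _ ↦ ?_
    have h := mul_inv_cancel_of_isUnit
      ((isUnit_one_sub_pow hq (2 * j + 1)).mul (isUnit_one_sub_mul_pow hq (-1) (2 * j)))
    linear_combination (1 + (X ^ 2) ^ (2 * j)) * (1 - (X ^ 2) ^ (2 * j + 1)) * h
  have ho := prod_partSeries_odd_mul hr
  have he := prod_partSeries_even_mul hr
  rw [prod_Icc_two_mul, ← prod_range_mul_prod_Ico (fun j ↦ 1 - (X ^ 2 : ℚ⟦X⟧) ^ (2 * j + 1)) hr,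
    ← prod_range_mul_prod_Ico (fun j ↦ 1 + (X ^ 2 : ℚ⟦X⟧) ^ (2 * j + 1)) hr]
  generalize kummerTerm (X ^ 2 : ℚ⟦X⟧) (-1) r = k at *
  generalize ∏ j ∈ range K, partSeries (2 * j + 1) _ = o at *
  generalize ∏ j ∈ range K, partSeries (2 * j + 2) _ = e at *
  generalize ∏ j ∈ range r, (1 - (X ^ 2 : ℚ⟦X⟧) ^ (2 * j + 2)) = g at *
  generalize ∏ j ∈ range r, (1 - (X ^ 2 : ℚ⟦X⟧) ^ (2 * j + 1)) = a at *
  generalize ∏ j ∈ range r, (1 + (X ^ 2 : ℚ⟦X⟧) ^ (2 * j + 1)) = c at *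
  generalize ∏ j ∈ range r, (1 + (X ^ 2 : ℚ⟦X⟧) ^ (2 * j)) = h at *
  generalize ∏ j ∈ Ico r K, (1 - (X ^ 2 : ℚ⟦X⟧) ^ (2 * j + 1)) = b at *
  generalize ∏ j ∈ Ico r K, (1 + (X ^ 2 : ℚ⟦X⟧) ^ (2 * j + 1)) = d at *
  refine hg.mul_left_cancel ?_
  linear_combination (-1) ^ r * e * a * g * ho + (-1) ^ r * a * d * he - d * hk

theorem finite_overEOStar (n : ℕ) :
    {p : Multiset ℕ × Finset ℕ | OverEOStar p ∧ p.1.sum = n}.Finite := by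
  refine ((finite_isPartition_sum_eq (S := {m | IsPartition m}) (fun _ h ↦ h) n).prod
    (Icc 1 n).powerset.finite_toSet).subset ?_
  rintro ⟨m, s⟩ ⟨⟨⟨hm, hs⟩, -⟩, hsum⟩
  exact ⟨⟨hm, hsum⟩, mem_coe.2 <| mem_powerset.2 fun x hx ↦
    hm.mem_Icc hsum.le (Multiset.mem_toFinset.1 (hs hx))⟩

theorem ncard_sub_ncard_eq_coeff_sum {n N K : ℕ} (hN : n < 2 * N) (hK : n ≤ 2 * K)
    (hNK : N ≤ K + 1) :
    ({p : Multiset ℕ × Finset ℕ | OverEOStar p ∧ p.1.sum = n ∧ 4 ∣ lep p.1}.ncard : ℚ) -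
      ({p : Multiset ℕ × Finset ℕ | OverEOStar p ∧ p.1.sum = n ∧ ¬ 4 ∣ lep p.1}.ncard : ℚ) =
    coeff n (∑ r ∈ range N, (-1) ^ r * ∏ x ∈ Icc 1 (2 * K), partSeries x
        fun c ↦ if EOCount r x c then if c = 0 then 1 else 2 else 0) := by
  have hfilter (Q : Multiset ℕ × Finset ℕ → Prop) [DecidablePred Q] :
      ({p | OverEOStar p ∧ p.1.sum = n ∧ Q p}.ncard : ℚ) =
        ∑ p ∈ (finite_overEOStar n).toFinset, if Q p then 1 else 0 := by
    rw [← sum_filter, sum_const, nsmul_one, ← Set.ncard_coe_finset]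
    congr 2
    ext p
    simp [and_assoc]
  have hsign (p : Multiset ℕ × Finset ℕ) :
      ((if 4 ∣ lep p.1 then 1 else 0) - if ¬ 4 ∣ lep p.1 then 1 else 0 : ℚ) =
        (-1) ^ (lep p.1 / 2) := by
    obtain ⟨k, hk⟩ := (even_lep p.1).two_dvd
    rw [hk, Nat.mul_div_cancel_left k two_pos]
    rcases Nat.even_or_odd k with h | h
    · have : 4 ∣ 2 * k := by
        obtain ⟨l, rfl⟩ := h
        exact ⟨l, by ring⟩
      simp [this, h.neg_one_pow]
    · have : ¬ 4 ∣ 2 * k := by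
        obtain ⟨l, rfl⟩ := h
        lia
      simp [this, h.neg_one_pow]
  rw [hfilter, hfilter, ← sum_sub_distrib, sum_congr rfl fun p _ ↦ hsign p,
    ← sum_fiberwise_of_maps_to (t := range N) (g := fun p ↦ lep p.1 / 2), map_sum]
  · refine sum_congr rfl fun r hr ↦ ?_
    have hr := mem_range.1 hr
    rw [sum_congr rfl fun p hp ↦ by rw [(mem_filter.1 hp).2], sum_const, nsmul_eq_mul,
      show ((-1) ^ r : ℚ⟦X⟧) = C ((-1) ^ r) by simp, coeff_C_mul, mul_comm,
      ← ncard_overpartition_eq_coeff_prod (EOCount r) hK, ← Set.ncard_coe_finset]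
    congr 3
    ext p
    simp only [coe_filter, Set.Finite.mem_toFinset, Set.mem_ofPred_eq]
    constructor
    · rintro ⟨⟨h, hs⟩, hl⟩
      have := (even_lep p.1).two_dvd
      have := (overEOStar_and_lep_eq_iff (r := r) (hs.trans_le hK) (by lia)).1 ⟨h, by lia⟩
      exact ⟨this.1, hs, this.2⟩
    · rintro ⟨h, hs, hc⟩
      have := (overEOStar_and_lep_eq_iff (r := r) (hs.trans_le hK) (by lia)).2 ⟨h, hc⟩
      exact ⟨⟨this.1, hs⟩, by lia⟩
  · intro p hp
    have := lep_le_sum p.1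
    have hp := ((finite_overEOStar n).mem_toFinset.1 hp).2
    exact mem_range.2 (by lia)

end EvenOdd

/-- For every positive integer `n`, the sum of `w(π)` over overpartitions `π ∈ EO̅*` of
`n` equals the number of quadruples `(α, β, γ, δ)` of partitions with
`|α| + |β| + |γ| + |δ| = n`, where `α` has distinct parts divisible by `4`, `β` and
`γ` have distinct parts `≡ 4 (mod 8)`, and all parts of `δ` are `≡ 4 (mod 8)`. -/
theorem stmt11 (n : ℕ) (hn : 0 < n) :
    ({p : Multiset ℕ × Finset ℕ |
        OverEOStar p ∧ p.1.sum = n ∧ 4 ∣ lep p.1}.ncard : ℤ) -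
    ({p : Multiset ℕ × Finset ℕ |
        OverEOStar p ∧ p.1.sum = n ∧ ¬ 4 ∣ lep p.1}.ncard : ℤ) =
    ({q : (Multiset ℕ × Multiset ℕ) × (Multiset ℕ × Multiset ℕ) |
        IsPartition q.1.1 ∧ q.1.1.Nodup ∧ (∀ x ∈ q.1.1, 4 ∣ x) ∧
        q.1.2.Nodup ∧ (∀ x ∈ q.1.2, x % 8 = 4) ∧
        q.2.1.Nodup ∧ (∀ x ∈ q.2.1, x % 8 = 4) ∧
        (∀ x ∈ q.2.2, x % 8 = 4) ∧
        q.1.1.sum + q.1.2.sum + q.2.1.sum + q.2.2.sum = n}.ncard : ℤ) := by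
  obtain ⟨F, hF, hdvd⟩ := exists_series_coeff_eq_ncard_quadruples (n + 1)
  have hL := ncard_sub_ncard_eq_coeff_sum (n := n) (N := 2 * (n + 1) + 1) (K := 2 * (n + 1))
    (by lia) (by lia) le_rfl
  have hq : PowerSeries.constantCoeff (PowerSeries.X ^ 2 : PowerSeries ℚ) = 0 := by simp
  have hsum := pow_dvd_prod_mul_sum_kummerTerm_neg_one_sub hq
    (n := 2 * (n + 1) + 1) (J := n + 1) (by lia) (by lia)
  generalize hJ : n + 1 = J at *
  have hL' := Finset.sum_congr rfl fun r (hr : r ∈ Finset.range (2 * J + 1)) ↦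
    prod_partSeries_eoCount_mul (Finset.mem_range_succ_iff.1 hr)
  rw [← Finset.sum_mul, ← Finset.mul_sum] at hL'
  rw [← pow_mul] at hsum
  replace hsum := (pow_dvd_pow (PowerSeries.X : PowerSeries ℚ)
    (show n + 1 ≤ 2 * (2 * J + 1) by lia)).trans hsum
  replace hdvd := (pow_dvd_pow (PowerSeries.X : PowerSeries ℚ)
    (show n + 1 ≤ 8 * J + 1 by lia)).trans hdvd
  have e₁ : ∏ j ∈ Finset.range (2 * J), (1 - PowerSeries.X ^ (8 * j + 4) : PowerSeries ℚ) =
      (∏ j ∈ Finset.range (2 * J), (1 + (PowerSeries.X ^ 2) ^ (2 * j + 1))) *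
        ∏ j ∈ Finset.range (2 * J), (1 - (PowerSeries.X ^ 2) ^ (2 * j + 1)) := by
    rw [← Finset.prod_mul_distrib]
    exact Finset.prod_congr rfl fun j _ ↦ by ring
  have e₂ : ∏ j ∈ Finset.range (2 * J), (1 + PowerSeries.X ^ (4 * j + 4) : PowerSeries ℚ) =
      ∏ j ∈ Finset.range (2 * J), (1 + (PowerSeries.X ^ 2) ^ (2 * j + 2)) :=
    Finset.prod_congr rfl fun j _ ↦ by ring
  have e₃ : (∏ j ∈ Finset.range J, (1 + PowerSeries.X ^ (8 * j + 4) : PowerSeries ℚ)) ^ 2 =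
      ∏ j ∈ Finset.range J, (1 + (PowerSeries.X ^ 2) ^ (4 * j + 2)) ^ 2 := by
    rw [← Finset.prod_pow]
    exact Finset.prod_congr rfl fun j _ ↦ by ring
  rw [e₁, e₂, e₃] at hdvd
  have hA : IsUnit (∏ j ∈ Finset.range (2 * J),
      (1 + (PowerSeries.X ^ 2 : PowerSeries ℚ) ^ (2 * j + 1))) :=
    IsUnit.prod_iff.2 fun j _ ↦ by simpa using PowerSeries.isUnit_one_sub_mul_pow hq (-1) (2 * j)
  have hB : IsUnit (∏ j ∈ Finset.range (2 * J),
      (1 - (PowerSeries.X ^ 2 : PowerSeries ℚ) ^ (2 * j + 1))) :=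
    IsUnit.prod_iff.2 fun j _ ↦ PowerSeries.isUnit_one_sub_pow hq (2 * j)
  have key : PowerSeries.X ^ (n + 1) ∣ ∑ r ∈ Finset.range (2 * J + 1),
      (-1) ^ r * ∏ x ∈ Finset.Icc 1 (2 * (2 * J)), partSeries x
        (fun c ↦ if EOCount r x c then if c = 0 then 1 else 2 else 0) - F := by
    rw [← (hA.mul hB).dvd_mul_left]
    convert! dvd_sub hsum hdvd using 1
    linear_combination (∏ j ∈ Finset.range (2 * J),
      (1 + (PowerSeries.X ^ 2 : PowerSeries ℚ) ^ (2 * j + 1))) * hL'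
  rw [X_pow_dvd_sub_iff.1 key n n.lt_succ_self, hF] at hL
  exact_mod_cast hL
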